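/- Let I and J be finite interpretations. Let Z, Z_I, Z_J be the maximal ALC bisimulations between I and J, between I and I, and between J and J, respectively. Let N_I = {d ∈ Δ^I : (d,e) ∉ Z_I for all e ∈ Δ^I with e ≠ d} and N_J = {d ∈ Δ^J : (d,e) ∉ Z_J for all e ∈ Δ^J with e ≠ d}. Define W as follows: W = Z if N_I = ∅ and N_J = ∅; W = ∅ if exactly one of N_I, N_J is empty; otherwise (both nonempty) W = Z if Z is total over Δ^I × Δ^J and Z ∩ (N_I × N_J) is total over N_I × N_J, and W = ∅ otherwise. Then W is an ALCι_G bisimulation between I and J, and every ALCι_G bisimulation between I and J is contained in W; i.e., W is the maximal ALCι_G bisimulation between I and J. -/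

import Mathlib

universe u v

namespace DL

/-- ALCι concepts, with atomic concept names and role names both drawn from
the countably infinite (and disjoint, being distinct sorts) sets `ℕ`. -/
inductive Concept : Type
  | atom : ℕ → Concept
  | neg : Concept → Concept
  | conj : Concept → Concept → Concept
  | ex : ℕ → Concept → Concept
  | iotaL : Concept → Concept
  | iotaG : Concept → Concept → Concept
  deriving DecidableEq

/-- An interpretation with (nonempty) domain `D`. -/
structure Interp (D : Type u) where
  atomI : ℕ → Set D
  roleI : ℕ → Set (D × D)

/-- The extension `C^I` of a concept `C` in the interpretation `I`. -/
def Interp.sem {D : Type u} (I : Interp D) : Concept → Set D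
  | .atom A => I.atomI A
  | .neg C => (I.sem C)ᶜ
  | .conj C D' => I.sem C ∩ I.sem D'
  | .ex r C => {d | ∃ e, (d, e) ∈ I.roleI r ∧ e ∈ I.sem C}
  | .iotaL C => {d | I.sem C = {d}}
  | .iotaG C D' => {_d | ∃ e, I.sem C = {e} ∧ e ∈ I.sem D'}

/-- Concepts not using the global definite description constructor `ιC.D`,
i.e. ALCι_L concepts. -/
def Concept.noG : Concept → Prop
  | .atom _ => True
  | .neg C => C.noG
  | .conj C D => C.noG ∧ D.noG
  | .ex _ C => C.noG
  | .iotaL C => C.noG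
  | .iotaG _ _ => False

/-- Concepts not using the local definite description constructor `{ιC}`,
i.e. ALCι_G concepts. -/
def Concept.noL : Concept → Prop
  | .atom _ => True
  | .neg C => C.noL
  | .conj C D => C.noL ∧ D.noL
  | .ex _ C => C.noL
  | .iotaL _ => False
  | .iotaG C D => C.noL ∧ D.noL

/-- ALC concepts: neither local nor global definite descriptions. -/
def Concept.isALC (C : Concept) : Prop := C.noG ∧ C.noL

/-- Condition (Atom) for a relation `Z ⊆ Δ^I × Δ^J`. -/
def AtomCond {D : Type u} {E : Type v} (I : Interp D) (J : Interp E) (Z : Set (D × E)) : Prop :=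
  ∀ p ∈ Z, ∀ A : ℕ, p.1 ∈ I.atomI A ↔ p.2 ∈ J.atomI A

/-- Condition (Forth). -/
def ForthCond {D : Type u} {E : Type v} (I : Interp D) (J : Interp E) (Z : Set (D × E)) : Prop :=
  ∀ p ∈ Z, ∀ r : ℕ, ∀ d' : D, (p.1, d') ∈ I.roleI r →
    ∃ e' : E, (p.2, e') ∈ J.roleI r ∧ (d', e') ∈ Z

/-- Condition (Back). -/
def BackCond {D : Type u} {E : Type v} (I : Interp D) (J : Interp E) (Z : Set (D × E)) : Prop :=
  ∀ p ∈ Z, ∀ r : ℕ, ∀ e' : E, (p.2, e') ∈ J.roleI r →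
    ∃ d' : D, (p.1, d') ∈ I.roleI r ∧ (d', e') ∈ Z

/-- `Names(Δ', I)`: the set of ALC concepts whose extension in `I` is a
singleton `{d}` with `d ∈ Δ'`. -/
def Names {D : Type u} (Δ' : Set D) (I : Interp D) : Set Concept :=
  {C | C.isALC ∧ ∃ d ∈ Δ', I.sem C = {d}}

/-- The domain of a relation. -/
def Dom {D : Type u} {E : Type v} (Z : Set (D × E)) : Set D := {d | ∃ e, (d, e) ∈ Z}

/-- The range of a relation. -/
def Rng {D : Type u} {E : Type v} (Z : Set (D × E)) : Set E := {e | ∃ d, (d, e) ∈ Z}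

/-- ALCι_L bisimulations between `I` and `J`. -/
def IsBisimL {D : Type u} {E : Type v} (I : Interp D) (J : Interp E) (Z : Set (D × E)) : Prop :=
  Z = ∅ ∨ (AtomCond I J Z ∧ ForthCond I J Z ∧ BackCond I J Z ∧
    Names (Dom Z) I = Names (Rng Z) J)

/-- ALCι_G bisimulations between `I` and `J`. -/
def IsBisimG {D : Type u} {E : Type v} (I : Interp D) (J : Interp E) (Z : Set (D × E)) : Prop :=
  Z = ∅ ∨ (AtomCond I J Z ∧ ForthCond I J Z ∧ BackCond I J Z ∧
    Names (Set.univ : Set D) I = Names (Set.univ : Set E) J)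

/-- ALC bisimulations between `I` and `J`. -/
def IsBisimALC {D : Type u} {E : Type v} (I : Interp D) (J : Interp E) (Z : Set (D × E)) : Prop :=
  AtomCond I J Z ∧ ForthCond I J Z ∧ BackCond I J Z

/-- The maximal ALC bisimulation between `I` and `J`: the union of all ALC
bisimulations between them. -/
def maxBisimALC {D : Type u} {E : Type v} (I : Interp D) (J : Interp E) : Set (D × E) :=
  ⋃₀ {Z | IsBisimALC I J Z}

/-- `NamedInd(Δ', I)`: the named individuals of `Δ'`. -/
def NamedInd {D : Type u} (Δ' : Set D) (I : Interp D) : Set D :=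
  {d ∈ Δ' | ∃ C ∈ Names Δ' I, d ∈ I.sem C}

/-- A relation `Z` is total over `X × Y`. -/
def TotalOver {D : Type u} {E : Type v} (Z : Set (D × E)) (X : Set D) (Y : Set E) : Prop :=
  (∀ x ∈ X, ∃ y ∈ Y, (x, y) ∈ Z) ∧ (∀ y ∈ Y, ∃ x ∈ X, (x, y) ∈ Z)

/-- Two individuals are ALC-equivalent if they belong to the same ALC concepts. -/
def ALCEquiv {D : Type u} {E : Type v} (I : Interp D) (J : Interp E) (d : D) (e : E) : Prop :=
  ∀ C : Concept, C.isALC → (d ∈ I.sem C ↔ e ∈ J.sem C)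

lemma ALCEquiv.symm {D : Type u} {E : Type v} {I : Interp D} {J : Interp E} {d : D} {e : E}
    (h : ALCEquiv I J d e) : ALCEquiv J I e d :=
  fun C hC => (h C hC).symm

lemma Concept.isALC.neg {C : Concept} (hC : C.isALC) : (Concept.neg C).isALC := hC

lemma Concept.isALC.conj {C C' : Concept} (hC : C.isALC) (hC' : C'.isALC) :
    (Concept.conj C C').isALC :=
  ⟨⟨hC.1, hC'.1⟩, ⟨hC.2, hC'.2⟩⟩

lemma Concept.isALC.ex {C : Concept} (r : ℕ) (hC : C.isALC) : (Concept.ex r C).isALC := hC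

/-- ALC concepts are invariant under ALC bisimulations. -/
lemma IsBisimALC.alcEquiv {D : Type u} {E : Type v} {I : Interp D} {J : Interp E}
    {Z : Set (D × E)} (hZ : IsBisimALC I J Z) {d : D} {e : E} (h : (d, e) ∈ Z) :
    ALCEquiv I J d e := by
  obtain ⟨hA, hF, hB⟩ := hZ
  intro C
  induction C generalizing d e with
  | atom A => exact fun _ => hA _ h A
  | neg C ih => exact fun hC => not_congr (ih h hC)
  | conj C C' ih ih' =>
    exact fun hC => and_congr (ih h ⟨hC.1.1, hC.2.1⟩) (ih' h ⟨hC.1.2, hC.2.2⟩)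
  | ex r C ih =>
    intro hC
    constructor
    · rintro ⟨d', hr, hd'⟩
      obtain ⟨e', hr', hz⟩ := hF _ h r d' hr
      exact ⟨e', hr', (ih hz hC).1 hd'⟩
    · rintro ⟨e', hr, he'⟩
      obtain ⟨d', hr', hz⟩ := hB _ h r e' hr
      exact ⟨d', hr', (ih hz hC).2 he'⟩
  | iotaL C => exact fun hC => hC.2.elim
  | iotaG C C' => exact fun hC => hC.1.elim

/-- An individual can be separated by one ALC concept from a finite set of individuals
none of which is ALC-equivalent to it. -/
lemma exists_separating_concept {D : Type u} {E : Type v} (I : Interp D) (J : Interp E) (d : D)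
    {S : Set E} (hS : S.Finite) (h : ∀ e ∈ S, ¬ ALCEquiv I J d e) :
    ∃ C : Concept, C.isALC ∧ d ∈ I.sem C ∧ ∀ e ∈ S, e ∉ J.sem C := by
  induction S, hS using Set.Finite.induction_on with
  | empty =>
    refine ⟨.neg (.conj (.atom 0) (.neg (.atom 0))), ?_, ?_, by simp⟩
    · simp [Concept.isALC, Concept.noG, Concept.noL]
    · simp [Interp.sem]
  | @insert e S _ _ ih =>
    obtain ⟨C, hC, hd, hCS⟩ := ih fun e' he' => h e' (Set.mem_insert_of_mem _ he')
    have hsep : ∃ C' : Concept, C'.isALC ∧ d ∈ I.sem C' ∧ e ∉ J.sem C' := by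
      have he := h e (Set.mem_insert _ _)
      simp only [ALCEquiv, not_forall] at he
      obtain ⟨C', hC', hne⟩ := he
      by_cases hdC : d ∈ I.sem C'
      · exact ⟨C', hC', hdC, fun heC => hne ⟨fun _ => heC, fun _ => hdC⟩⟩
      · refine ⟨.neg C', hC'.neg, hdC, fun heC => hne ⟨fun hd => (hdC hd).elim,
          fun he => (heC he).elim⟩⟩
    obtain ⟨C', hC', hd', he'⟩ := hsep
    refine ⟨.conj C C', hC.conj hC', ⟨hd, hd'⟩, ?_⟩
    rintro x (rfl | hx) hxC
    · exact he' hxC.2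
    · exact hCS x hx hxC.1

lemma ALCEquiv.forth {D : Type u} {E : Type v} [Finite E] {I : Interp D} {J : Interp E}
    {d d' : D} {e : E} (h : ALCEquiv I J d e) {r : ℕ} (hr : (d, d') ∈ I.roleI r) :
    ∃ e', (e, e') ∈ J.roleI r ∧ ALCEquiv I J d' e' := by
  by_contra! hne
  obtain ⟨C, hC, hd', hsep⟩ :=
    exists_separating_concept I J d' (Set.toFinite {e' | (e, e') ∈ J.roleI r}) hne
  obtain ⟨e', hre', he'⟩ := (h (.ex r C) (hC.ex r)).1 ⟨d', hr, hd'⟩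
  exact hsep e' hre' he'

/-- Hennessy–Milner: between finite interpretations, ALC-equivalence is the maximal
ALC bisimulation. -/
lemma mem_maxBisimALC_iff {D : Type u} {E : Type v} [Finite D] [Finite E]
    {I : Interp D} {J : Interp E} {d : D} {e : E} :
    (d, e) ∈ maxBisimALC I J ↔ ALCEquiv I J d e := by
  constructor
  · rintro ⟨Z, hZ, h⟩
    exact IsBisimALC.alcEquiv hZ h
  · intro h
    refine ⟨{p | ALCEquiv I J p.1 p.2}, ⟨?_, ?_, ?_⟩, h⟩
    · exact fun p hp A => hp (.atom A) ⟨trivial, trivial⟩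
    · exact fun p hp r d' hr => ALCEquiv.forth hp hr
    · intro p hp r e' hr
      obtain ⟨d', hr', h'⟩ := (ALCEquiv.symm hp).forth hr
      exact ⟨d', hr', h'.symm⟩

/-- The maximal ALC bisimulation is an ALC bisimulation. -/
lemma isBisimALC_maxBisimALC {D : Type u} {E : Type v} (I : Interp D) (J : Interp E) :
    IsBisimALC I J (maxBisimALC I J) := by
  refine ⟨?_, ?_, ?_⟩
  · rintro p ⟨Z, hZ, hp⟩
    exact hZ.1 p hp
  · rintro p ⟨Z, hZ, hp⟩ r d' hr
    obtain ⟨e', hr', h'⟩ := hZ.2.1 p hp r d' hr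
    exact ⟨e', hr', Z, hZ, h'⟩
  · rintro p ⟨Z, hZ, hp⟩ r e' hr
    obtain ⟨d', hr', h'⟩ := hZ.2.2 p hp r e' hr
    exact ⟨d', hr', Z, hZ, h'⟩

/-- The individuals that are not ALC-equivalent to any other individual. -/
def isolated {D : Type u} (I : Interp D) : Set D :=
  {d | ∀ e, e ≠ d → ¬ ALCEquiv I I d e}

lemma mem_isolated_of_sem_eq_singleton {D : Type u} {I : Interp D} {C : Concept}
    (hC : C.isALC) {d : D} (h : I.sem C = {d}) : d ∈ isolated I := by
  intro e hne heq
  have he := (heq C hC).1 (h ▸ rfl)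
  rw [h] at he
  exact hne he

lemma exists_sem_eq_singleton {D : Type u} [Finite D] {I : Interp D} {d : D}
    (hd : d ∈ isolated I) : ∃ C : Concept, C.isALC ∧ I.sem C = {d} := by
  obtain ⟨C, hC, hdC, hsep⟩ := exists_separating_concept I I d (Set.toFinite {e | e ≠ d}) hd
  refine ⟨C, hC, Set.Subset.antisymm (fun e he => ?_) (by simpa using hdC)⟩
  by_contra hne
  exact hsep e hne he

lemma isolated_eq_empty_iff {D : Type u} [Finite D] (I : Interp D) :
    isolated I = ∅ ↔ Names Set.univ I = ∅ := by
  simp only [Set.eq_empty_iff_forall_notMem]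
  constructor
  · rintro h C ⟨hC, d, -, hd⟩
    exact h d (mem_isolated_of_sem_eq_singleton hC hd)
  · intro h d hd
    obtain ⟨C, hC, hdC⟩ := exists_sem_eq_singleton hd
    exact h C ⟨hC, d, trivial, hdC⟩

lemma names_subset_of_total {D : Type u} {E : Type v} {I : Interp D} {J : Interp E}
    (htot : ∀ e, ∃ d, ALCEquiv I J d e)
    (hiso : ∀ d ∈ isolated I, ∃ e ∈ isolated J, ALCEquiv I J d e) :
    Names Set.univ I ⊆ Names Set.univ J := by
  rintro C ⟨hC, d, -, hd⟩
  obtain ⟨e, he, hde⟩ := hiso d (mem_isolated_of_sem_eq_singleton hC hd)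
  refine ⟨hC, e, trivial, Set.Subset.antisymm (fun e' he' => ?_) ?_⟩
  · obtain ⟨d', hd'⟩ := htot e'
    have hdd : d' = d := by
      have := (hd' C hC).2 he'
      rwa [hd] at this
    subst hdd
    by_contra hne
    exact he e' hne fun C' hC' => (hde C' hC').symm.trans (hd' C' hC')
  · rintro _ rfl
    exact (hde C hC).1 (hd ▸ rfl)

lemma exists_alcEquiv_of_names_eq {D : Type u} {E : Type v} [Finite E]
    {I : Interp D} {J : Interp E} (hN : Names Set.univ I = Names Set.univ J)
    (hne : (Names Set.univ I).Nonempty) (x : D) : ∃ y, ALCEquiv I J x y := by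
  by_contra! hx
  obtain ⟨B, hB, hxB, hsep⟩ :=
    exists_separating_concept I J x (Set.toFinite Set.univ) fun e _ => hx e
  obtain ⟨C, hCI⟩ := hne
  have hCJ : C ∈ Names Set.univ J := hN ▸ hCI
  obtain ⟨hC, d, -, hd⟩ := hCI
  obtain ⟨-, e, -, he⟩ := hCJ
  have hU : Concept.neg (.conj (.neg C) (.neg B)) ∈ Names Set.univ J := by
    refine ⟨(hC.neg.conj hB.neg).neg, e, trivial, ?_⟩
    have hBJ : J.sem B = ∅ := Set.eq_empty_iff_forall_notMem.2 fun y => hsep y trivial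
    simp [Interp.sem, hBJ, he]
  rw [← hN] at hU
  obtain ⟨-, d₁, -, hd₁⟩ := hU
  have hmem : ∀ z, z = d ∨ z ∈ I.sem B → z = d₁ := by
    intro z hz
    have : z ∈ I.sem (Concept.neg (.conj (.neg C) (.neg B))) := by
      simp only [Interp.sem, hd, Set.mem_compl_iff, Set.mem_inter_iff, Set.mem_singleton_iff]
      tauto
    rwa [hd₁] at this
  have hxd : x = d := (hmem x (.inr hxB)).trans (hmem d (.inl rfl)).symm
  have hI : Concept.conj C B ∈ Names Set.univ I := by
    refine ⟨hC.conj hB, d, trivial, ?_⟩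
    simpa [Interp.sem, hd, ← hxd] using hxB
  rw [hN] at hI
  obtain ⟨-, y, -, hy⟩ := hI
  have hyB : y ∈ J.sem (.conj C B) := hy ▸ rfl
  exact hsep y trivial hyB.2

lemma exists_isolated_alcEquiv_of_names_eq {D : Type u} {E : Type v} [Finite D] [Finite E]
    {I : Interp D} {J : Interp E} (hN : Names Set.univ I = Names Set.univ J)
    {d : D} (hd : d ∈ isolated I) : ∃ e ∈ isolated J, ALCEquiv I J d e := by
  obtain ⟨C, hC, hdC⟩ := exists_sem_eq_singleton hd
  have hCI : C ∈ Names Set.univ I := ⟨hC, d, trivial, hdC⟩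
  obtain ⟨e, he⟩ := exists_alcEquiv_of_names_eq hN ⟨C, hCI⟩ d
  obtain ⟨-, e', -, he'⟩ := hN ▸ hCI
  have hee : e ∈ J.sem C := (he C hC).1 (hdC ▸ rfl)
  rw [he'] at hee
  obtain rfl : e = e' := hee
  exact ⟨e, mem_isolated_of_sem_eq_singleton hC he', he⟩

/-- Once some individual is isolated, two finite interpretations have the same names iff
ALC-equivalence is total between them and between their isolated individuals. -/
lemma names_eq_iff_totalOver {D : Type u} {E : Type v} [Finite D] [Finite E]
    {I : Interp D} {J : Interp E} (hI : isolated I ≠ ∅) :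
    Names Set.univ I = Names Set.univ J ↔
      TotalOver (maxBisimALC I J) Set.univ Set.univ ∧
        TotalOver (maxBisimALC I J ∩ isolated I ×ˢ isolated J) (isolated I) (isolated J) := by
  constructor
  · intro hN
    have hne : (Names Set.univ I).Nonempty :=
      Set.nonempty_iff_ne_empty.2 (mt (isolated_eq_empty_iff I).2 hI)
    refine ⟨⟨fun x _ => ?_, fun y _ => ?_⟩, ⟨fun x hx => ?_, fun y hy => ?_⟩⟩
    · obtain ⟨y, h⟩ := exists_alcEquiv_of_names_eq hN hne x
      exact ⟨y, trivial, mem_maxBisimALC_iff.2 h⟩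
    · obtain ⟨x, h⟩ := exists_alcEquiv_of_names_eq hN.symm (hN ▸ hne) y
      exact ⟨x, trivial, mem_maxBisimALC_iff.2 h.symm⟩
    · obtain ⟨y, hy, h⟩ := exists_isolated_alcEquiv_of_names_eq hN hx
      exact ⟨y, hy, mem_maxBisimALC_iff.2 h, hx, hy⟩
    · obtain ⟨x, hx, h⟩ := exists_isolated_alcEquiv_of_names_eq hN.symm hy
      exact ⟨x, hx, mem_maxBisimALC_iff.2 h.symm, hx, hy⟩
  · rintro ⟨⟨h₁, h₂⟩, h₃, h₄⟩
    refine Set.Subset.antisymm (names_subset_of_total (fun e => ?_) fun d hd => ?_)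
      (names_subset_of_total (fun d => ?_) fun e he => ?_)
    · obtain ⟨d, -, h⟩ := h₂ e trivial
      exact ⟨d, mem_maxBisimALC_iff.1 h⟩
    · obtain ⟨e, he, h⟩ := h₃ d hd
      exact ⟨e, he, mem_maxBisimALC_iff.1 h.1⟩
    · obtain ⟨e, -, h⟩ := h₁ d trivial
      exact ⟨e, (mem_maxBisimALC_iff.1 h).symm⟩
    · obtain ⟨d, hd, h⟩ := h₄ e he
      exact ⟨d, hd, (mem_maxBisimALC_iff.1 h.1).symm⟩

/-- correctness of Algorithm 2.  With `Z`, `Z_I`, `Z_J` the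
maximal ALC bisimulations between `I` and `J`, `I` and `I`, `J` and `J`, and
`N_I`, `N_J` the individuals not ALC-bisimilar to a distinct individual, the
relation `W` defined by the case distinction of Algorithm 2 is the maximal
ALCι_G (= ALCι) bisimulation between `I` and `J`. -/
theorem stmt11 {D : Type u} {E : Type v} [Nonempty D] [Nonempty E]
    [Finite D] [Finite E]
    (I : Interp D) (J : Interp E)
    (Z : Set (D × E)) (ZI : Set (D × D)) (ZJ : Set (E × E))
    (hZ : Z = maxBisimALC I J) (hZI : ZI = maxBisimALC I I)
    (hZJ : ZJ = maxBisimALC J J)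
    (NI : Set D) (NJ : Set E)
    (hNI : NI = {d : D | ∀ e : D, e ≠ d → (d, e) ∉ ZI})
    (hNJ : NJ = {d : E | ∀ e : E, e ≠ d → (d, e) ∉ ZJ})
    (W : Set (D × E))
    (hW1 : NI = ∅ ∧ NJ = ∅ → W = Z)
    (hW2 : (NI = ∅ ∧ NJ ≠ ∅) ∨ (NI ≠ ∅ ∧ NJ = ∅) → W = ∅)
    (hW3 : NI ≠ ∅ → NJ ≠ ∅ →
      TotalOver Z Set.univ Set.univ ∧ TotalOver (Z ∩ NI ×ˢ NJ) NI NJ →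
      W = Z)
    (hW4 : NI ≠ ∅ → NJ ≠ ∅ →
      ¬(TotalOver Z Set.univ Set.univ ∧ TotalOver (Z ∩ NI ×ˢ NJ) NI NJ) →
      W = ∅) :
    IsBisimG I J W ∧ ∀ Z' : Set (D × E), IsBisimG I J Z' → Z' ⊆ W := by
  have hNI' : NI = isolated I := by
    simp only [hNI, hZI, mem_maxBisimALC_iff, isolated]
  have hNJ' : NJ = isolated J := by
    simp only [hNJ, hZJ, mem_maxBisimALC_iff, isolated]
  clear hNI hNJ hZI hZJ
  subst hNI' hNJ' hZ
  have hW : (Names Set.univ I = Names Set.univ J → W = maxBisimALC I J) ∧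
      (Names Set.univ I ≠ Names Set.univ J → W = ∅) := by
    by_cases hI : isolated I = ∅ <;> by_cases hJ : isolated J = ∅
    · have hN : Names Set.univ I = Names Set.univ J :=
        ((isolated_eq_empty_iff I).1 hI).trans ((isolated_eq_empty_iff J).1 hJ).symm
      exact ⟨fun _ => hW1 ⟨hI, hJ⟩, fun h => (h hN).elim⟩
    · refine ⟨fun hN => (hJ ?_).elim, fun _ => hW2 (.inl ⟨hI, hJ⟩)⟩
      rwa [isolated_eq_empty_iff, ← hN, ← isolated_eq_empty_iff]
    · refine ⟨fun hN => (hI ?_).elim, fun _ => hW2 (.inr ⟨hI, hJ⟩)⟩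
      rwa [isolated_eq_empty_iff, hN, ← isolated_eq_empty_iff]
    · exact ⟨fun hN => hW3 hI hJ ((names_eq_iff_totalOver hI).1 hN),
        fun hN => hW4 hI hJ (mt (names_eq_iff_totalOver hI).2 hN)⟩
  by_cases hN : Names Set.univ I = Names Set.univ J
  · rw [hW.1 hN]
    obtain ⟨hA, hF, hB⟩ := isBisimALC_maxBisimALC I J
    refine ⟨.inr ⟨hA, hF, hB, hN⟩, ?_⟩
    rintro Z' (rfl | ⟨hA', hF', hB', -⟩)
    · exact Set.empty_subset _
    · exact Set.subset_sUnion_of_mem ⟨hA', hF', hB'⟩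
  · refine ⟨.inl (hW.2 hN), ?_⟩
    rintro Z' (rfl | ⟨-, -, -, h⟩)
    · exact Set.empty_subset _
    · exact (hN h).elim

end DL
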